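/- arXiv:2105.08211 — 4 statements merged into one kernel-verified Lean document; each statement's English description precedes it below -/
import Mathlib

section
/- (Lemma 3.6, (1)⇔(2)) Let B be a skew-symmetrizable n×n integer matrix. Then the mutation class [B] is infinite if and only if there exists an infinite sequence of indices k_1, k_2, … such that the weights w(μ_{k_m}∘⋯∘μ_{k_1}(B)) for m ∈ ℕ are unbounded. -/
/-- Fomin–Zelevinsky mutation of an `n × n` integer matrix in direction `k`. -/
def mutate {n : ℕ} (B : Matrix (Fin n) (Fin n) ℤ) (k : Fin n) : Matrix (Fin n) (Fin n) ℤ :=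
  fun i j => if i = k ∨ j = k then -B i j
    else B i j + Int.sign (B i k) * max 0 (B i k * B k j)

/-- `B` is skew-symmetrizable: there are positive integers `d i` with
`d i * B i j = -(d j * B j i)` for all `i, j`. -/
def IsSkewSymmetrizable {n : ℕ} (B : Matrix (Fin n) (Fin n) ℤ) : Prop :=
  ∃ d : Fin n → ℤ, (∀ i, 0 < d i) ∧ ∀ i j, d i * B i j = -(d j * B j i)

/-- The mutation class of `B`: all matrices obtained from `B` by finite sequences of
mutations (including `B` itself). -/
def mutationClass {n : ℕ} (B : Matrix (Fin n) (Fin n) ℤ) : Set (Matrix (Fin n) (Fin n) ℤ) :=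
  {B' | ∃ l : List (Fin n), B' = l.foldl mutate B}

/-- The action of a permutation on a matrix: `(σ·B) i j = B (σ⁻¹ i) (σ⁻¹ j)`. -/
def permMat {n : ℕ} (σ : Equiv.Perm (Fin n)) (B : Matrix (Fin n) (Fin n) ℤ) :
    Matrix (Fin n) (Fin n) ℤ :=
  fun i j => B (σ⁻¹ i) (σ⁻¹ j)

/-- The weight of `B`: the maximum of `|B i j * B j i|` over pairs `i ≠ j`. -/
def matWeight {n : ℕ} (B : Matrix (Fin n) (Fin n) ℤ) : ℕ :=
  Finset.univ.sup (fun p : Fin n × Fin n =>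
    if p.1 = p.2 then 0 else (B p.1 p.2 * B p.2 p.1).natAbs)

/-- `B` is vertex-to-vertex, σ-symmetric: for every index `k` there are a permutation `σ`
and a sign `ε ∈ {1, -1}` such that either `μ_k(B) = ε·(σ·B)` or there is an index `j`
with `μ_j(μ_k(B)) = ε·(σ·B)`. -/
def IsVVSymmetric {n : ℕ} (B : Matrix (Fin n) (Fin n) ℤ) : Prop :=
  ∀ k : Fin n, ∃ (σ : Equiv.Perm (Fin n)) (ε : ℤ), (ε = 1 ∨ ε = -1) ∧
    (mutate B k = ε • permMat σ B ∨ ∃ j : Fin n, mutate (mutate B k) j = ε • permMat σ B)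

theorem mutate_mutate {n : ℕ} (B : Matrix (Fin n) (Fin n) ℤ) (k : Fin n) :
    mutate (mutate B k) k = B := by
  funext i j
  by_cases hi : i = k
  · simp [mutate, hi]
  by_cases hj : j = k
  · simp [mutate, hj]
  simp [mutate, hi, hj]

theorem foldl_mutate_reverse {n : ℕ} (l : List (Fin n)) (B : Matrix (Fin n) (Fin n) ℤ) :
    l.reverse.foldl mutate (l.foldl mutate B) = B := by
  induction l generalizing B with
  | nil => rfl
  | cons a l ih =>
    simp only [List.reverse_cons, List.foldl_append, List.foldl_cons, List.foldl_nil, ih]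
    exact mutate_mutate B a

theorem mutate_skew_aux (di dj dk a b c e : ℤ) (hi : 0 < di) (hj : 0 < dj) (hk : 0 < dk)
    (h1 : di * a = -(dk * c)) (h2 : dj * e = -(dk * b)) :
    di * (Int.sign a * max 0 (a * b)) = -(dj * (Int.sign e * max 0 (e * c))) := by
  have key : ∀ x y d d' : ℤ, 0 < d → 0 < d' → d * x = -(d' * y) → y.sign = - x.sign := by
    intro x y d d' hd hd' h
    have := congrArg Int.sign h
    rw [Int.sign_neg, Int.sign_mul, Int.sign_mul, Int.sign_eq_one_of_pos hd,
      Int.sign_eq_one_of_pos hd'] at this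
    linarith
  have hc := key a c di dk hi hk h1
  have hb := key e b dj dk hj hk h2
  have hp : di * (a * b) = dj * (e * c) := by
    have e1 : di * (a * b) = (di * a) * b := by ring
    have e2 : dj * (e * c) = (dj * e) * c := by ring
    rw [e1, e2, h1, h2]; ring
  have hm : di * max 0 (a * b) = dj * max 0 (e * c) := by
    rw [mul_max_of_nonneg _ _ hi.le, mul_max_of_nonneg _ _ hj.le, hp]; simp
  by_cases hpos : 0 < a * b
  · have hs : a.sign = b.sign := by
      rcases pos_and_pos_or_neg_and_neg_of_mul_pos hpos with ⟨h, h'⟩ | ⟨h, h'⟩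
      · rw [Int.sign_eq_one_of_pos h, Int.sign_eq_one_of_pos h']
      · rw [Int.sign_eq_neg_one_of_neg h, Int.sign_eq_neg_one_of_neg h']
    have : e.sign = - a.sign := by rw [hs, hb]; ring
    rw [this]
    linear_combination a.sign * hm
  · have z : max 0 (a * b) = 0 := max_eq_left (not_lt.mp hpos)
    rw [z] at hm ⊢
    linear_combination -e.sign * hm

theorem mutate_skew {n : ℕ} (d : Fin n → ℤ) (hd : ∀ i, 0 < d i)
    (B : Matrix (Fin n) (Fin n) ℤ) (h : ∀ i j, d i * B i j = -(d j * B j i)) (k : Fin n) :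
    ∀ i j, d i * mutate B k i j = -(d j * mutate B k j i) := by
  intro i j
  by_cases hc : i = k ∨ j = k
  · have := h i j
    simp only [mutate, if_pos hc, if_pos hc.symm]
    linarith
  · have hc' : ¬ (j = k ∨ i = k) := fun x => hc x.symm
    simp only [mutate, if_neg hc, if_neg hc']
    have := mutate_skew_aux (d i) (d j) (d k) (B i k) (B k j) (B k i) (B j k)
      (hd i) (hd j) (hd k) (h i k) (h j k)
    linear_combination this + h i j

theorem foldl_mutate_skew {n : ℕ} (d : Fin n → ℤ) (hd : ∀ i, 0 < d i) (l : List (Fin n))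
    (B : Matrix (Fin n) (Fin n) ℤ) (h : ∀ i j, d i * B i j = -(d j * B j i)) :
    ∀ i j, d i * l.foldl mutate B i j = -(d j * l.foldl mutate B j i) := by
  induction l generalizing B with
  | nil => exact h
  | cons a l ih => exact ih _ (mutate_skew d hd B h a)

theorem entry_le_weight {n : ℕ} (d : Fin n → ℤ) (hd : ∀ i, 0 < d i)
    (B : Matrix (Fin n) (Fin n) ℤ) (h : ∀ i j, d i * B i j = -(d j * B j i)) (i j : Fin n) :
    (B i j).natAbs ≤ matWeight B := by
  by_cases hij : i = j
  · subst hij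
    have h1 : d i * B i i = 0 := by linarith [h i i]
    have : B i i = 0 := (mul_eq_zero.mp h1).resolve_left (hd i).ne'
    simp [this]
  · have h1 : (B i j * B j i).natAbs ≤ matWeight B := by
      have := Finset.le_sup (f := fun p : Fin n × Fin n =>
        if p.1 = p.2 then 0 else (B p.1 p.2 * B p.2 p.1).natAbs) (Finset.mem_univ (i, j))
      simpa [hij, matWeight] using this
    refine le_trans ?_ h1
    by_cases hz : B j i = 0
    · have h2 : d i * B i j = 0 := by rw [h i j, hz]; ring
      have : B i j = 0 := (mul_eq_zero.mp h2).resolve_left (hd i).ne'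
      simp [this]
    · rw [Int.natAbs_mul]
      exact Nat.le_mul_of_pos_right _ (Int.natAbs_pos.mpr hz)

theorem exists_big {n : ℕ} (B : Matrix (Fin n) (Fin n) ℤ) (hB : IsSkewSymmetrizable B)
    (hinf : (mutationClass B).Infinite) (N : ℕ) :
    ∃ l : List (Fin n), N < matWeight (l.foldl mutate B) := by
  by_contra hcon
  push Not at hcon
  obtain ⟨d, hd, h⟩ := hB
  apply hinf
  have hfin : (Set.pi Set.univ (fun _ : Fin n => Set.pi Set.univ
      (fun _ : Fin n => Set.Icc (-(N : ℤ)) N))).Finite :=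
    Set.Finite.pi' (fun _ => Set.Finite.pi' (fun _ => Set.finite_Icc _ _)) |>.subset
      (by intro x hx i j; exact hx i trivial j trivial)
  refine hfin.subset ?_
  rintro _ ⟨l, rfl⟩ i - j -
  have h1 := entry_le_weight d hd _ (foldl_mutate_skew d hd l B h) i j
  have h2 := hcon l
  simp only [Set.mem_Icc]
  omega

/-- Concatenated walks. -/
def walks {n : ℕ} (k0 : Fin n) (L : ℕ → List (Fin n)) : ℕ → List (Fin n)
  | 0 => []
  | N + 1 => (walks k0 L N ++ ((walks k0 L N).reverse ++ L N)) ++ [k0]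

theorem walks_prefix {n : ℕ} (k0 : Fin n) (L : ℕ → List (Fin n)) {a b : ℕ} (hab : a ≤ b) :
    walks k0 L a <+: walks k0 L b := by
  induction hab with
  | refl => exact List.prefix_rfl
  | step _ ih =>
    refine ih.trans ?_
    rw [walks, List.append_assoc]
    exact List.prefix_append _ _

theorem walks_length {n : ℕ} (k0 : Fin n) (L : ℕ → List (Fin n)) (a : ℕ) :
    a ≤ (walks k0 L a).length := by
  induction a with
  | zero => simp
  | succ a ih =>
    simp only [walks, List.length_append, List.length_singleton]
    omega

theorem ofFn_walks {n : ℕ} (k0 : Fin n) (L : ℕ → List (Fin n)) (Q : List (Fin n)) (M : ℕ)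
    (hQ : Q <+: walks k0 L M) :
    List.ofFn (fun t : Fin Q.length => (walks k0 L (t.1 + 1)).getD t.1 k0) = Q := by
  apply List.ext_getElem
  · simp
  intro t h1 h2
  have ht : t < (walks k0 L (t + 1)).length := walks_length k0 L (t + 1)
  rw [List.getElem_ofFn, List.getD_eq_getElem _ _ ht]
  have hQ2 := hQ.trans (walks_prefix k0 L (le_max_left M (t + 1)))
  have hW := walks_prefix k0 L (le_max_right M (t + 1))
  rw [hQ2.getElem h2, hW.getElem ht]

theorem mutation_class_infinite_iff_unbounded_weights (n : ℕ) (hn : 1 ≤ n)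
    (B : Matrix (Fin n) (Fin n) ℤ) (hB : IsSkewSymmetrizable B) :
    (mutationClass B).Infinite ↔
      ∃ f : ℕ → Fin n, ∀ N : ℕ, ∃ m : ℕ,
        N < matWeight ((List.ofFn (fun t : Fin m => f t.1)).foldl mutate B) := by
  constructor
  · intro hinf
    choose L hL using exists_big B hB hinf
    let k0 : Fin n := ⟨0, hn⟩
    refine ⟨fun t => (walks k0 L (t + 1)).getD t k0, fun N => ?_⟩
    let Q := walks k0 L N ++ ((walks k0 L N).reverse ++ L N)
    refine ⟨Q.length, ?_⟩
    have hQ : Q <+: walks k0 L (N + 1) := List.prefix_append _ _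
    have e := ofFn_walks k0 L Q (N + 1) hQ
    simp only [e]
    simp only [Q, List.foldl_append, foldl_mutate_reverse]
    exact hL N
  · rintro ⟨f, hf⟩ hfin
    obtain ⟨N, hN⟩ := (hfin.image matWeight).bddAbove
    obtain ⟨m, hm⟩ := hf N
    exact absurd (hN ⟨_, ⟨_, rfl⟩, rfl⟩) (not_le.mpr hm)
end

section
/- (Lemma 3.6, (1)⇔(4)) Let B be a skew-symmetrizable n×n integer matrix. Then the mutation class [B] is infinite if and only if there exist a matrix B' ∈ [B] and pairwise distinct indices i, j, k forming an oriented 3-cycle in B' (that is, B'_{ij} > 0, B'_{jk} > 0, B'_{ki} > 0) whose three edge weights |B'_{ij}·B'_{ji}|, |B'_{jk}·B'_{kj}|, |B'_{ki}·B'_{ik}| are pairwise distinct (i.e., the 3-cycle is not isosceles). -/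
section MutHelpers

def SSd {n : ℕ} (d : Fin n → ℤ) (B : Matrix (Fin n) (Fin n) ℤ) : Prop :=
  (∀ i, 0 < d i) ∧ ∀ i j, d i * B i j = -(d j * B j i)

variable {n : ℕ} {d : Fin n → ℤ} {B : Matrix (Fin n) (Fin n) ℤ}

lemma mut_l (k j : Fin n) : mutate B k k j = -B k j := by simp [mutate]

lemma mut_r (k i : Fin n) : mutate B k i k = -B i k := by simp [mutate]

lemma mut_zero {i j k : Fin n} (hi : i ≠ k) (hj : j ≠ k) (h : B i k * B k j ≤ 0) :
    mutate B k i j = B i j := by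
  simp [mutate, hi, hj, max_eq_left h]

lemma mut_pos {i j k : Fin n} (hi : i ≠ k) (hj : j ≠ k) (h1 : 0 < B i k) (h2 : 0 < B k j) :
    mutate B k i j = B i j + B i k * B k j := by
  simp [mutate, hi, hj, max_eq_right (mul_pos h1 h2).le, Int.sign_eq_one_of_pos h1]

lemma mut_neg {i j k : Fin n} (hi : i ≠ k) (hj : j ≠ k) (h1 : B i k < 0) (h2 : B k j < 0) :
    mutate B k i j = B i j - B i k * B k j := by
  simp [mutate, hi, hj, max_eq_right (mul_pos_of_neg_of_neg h1 h2).le,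
    Int.sign_eq_neg_one_of_neg h1]
  ring

lemma SSd.neg (h : SSd d B) {i j : Fin n} (hp : 0 < B i j) : B j i < 0 := by
  have h1 := mul_pos (h.1 i) hp
  have h2 := h.2 i j
  by_contra hc
  have := mul_nonneg (h.1 j).le (not_lt.mp hc)
  linarith

lemma SSd.pos (h : SSd d B) {i j : Fin n} (hp : B i j < 0) : 0 < B j i := by
  have h1 := mul_neg_of_pos_of_neg (h.1 i) hp
  have h2 := h.2 i j
  by_contra hc
  have := mul_nonpos_of_nonneg_of_nonpos (h.1 j).le (not_lt.mp hc)
  linarith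

lemma SSd.zero (h : SSd d B) {i j : Fin n} (hp : B i j = 0) : B j i = 0 := by
  have h2 := h.2 i j
  have h3 := h.1 j
  rw [hp] at h2
  have : d j * B j i = 0 := by linarith
  rcases mul_eq_zero.mp this with h | h
  · omega
  · exact h

lemma SSd.tri (h : SSd d B) (i j k : Fin n) :
    B i j * B j k * B k i = -(B j i * B k j * B i k) := by
  have hd : d i * d j * d k ≠ 0 :=
    (mul_pos (mul_pos (h.1 i) (h.1 j)) (h.1 k)).ne'
  apply mul_left_cancel₀ hd
  calc d i * d j * d k * (B i j * B j k * B k i)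
      = (d i * B i j) * (d j * B j k) * (d k * B k i) := by ring
    _ = d i * d j * d k * -(B j i * B k j * B i k) := by
        rw [h.2 i j, h.2 j k, h.2 k i]; ring

lemma SSd.nonpos (h : SSd d B) {i j k l : Fin n} (hp : B i j * B k l ≤ 0) :
    B l k * B j i ≤ 0 := by
  by_contra hc
  rcases mul_pos_iff.mp (not_le.mp hc) with ⟨h1, h2⟩ | ⟨h1, h2⟩
  · have := mul_pos_of_neg_of_neg (h.neg h1) (h.neg h2); linarith
  · have := mul_pos (h.pos h1) (h.pos h2); linarith

lemma SSd.mutate (h : SSd d B) (k : Fin n) : SSd d (mutate B k) := by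
  refine ⟨h.1, fun i j => ?_⟩
  by_cases hi : i = k
  · subst hi; rw [mut_l, mut_r]; have := h.2 i j; linarith
  by_cases hj : j = k
  · subst hj; rw [mut_l, mut_r]; have := h.2 i j; linarith
  have e : d i * (B i k * B k j) = d j * (B j k * B k i) := by
    calc _ = (d i * B i k) * B k j := by ring
      _ = -(B k i) * (d k * B k j) := by rw [h.2 i k]; ring
      _ = _ := by rw [h.2 k j]; ring
  have e2 := h.2 i j
  by_cases hp : B i k * B k j ≤ 0
  · rw [mut_zero hi hj hp, mut_zero hj hi (h.nonpos hp)]; exact e2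
  rcases mul_pos_iff.mp (not_le.mp hp) with ⟨h1, h2⟩ | ⟨h1, h2⟩
  · rw [mut_pos hi hj h1 h2, mut_neg hj hi (h.neg h2) (h.neg h1)]; linarith
  · rw [mut_neg hi hj h1 h2, mut_pos hj hi (h.pos h2) (h.pos h1)]; linarith

lemma class_mutate {C : Matrix (Fin n) (Fin n) ℤ} (h : C ∈ mutationClass B) (k : Fin n) :
    mutate C k ∈ mutationClass B := by
  obtain ⟨l, rfl⟩ := h
  exact ⟨l ++ [k], by simp⟩

lemma class_ind (P : Matrix (Fin n) (Fin n) ℤ → Prop) (h0 : P B)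
    (hs : ∀ C ∈ mutationClass B, P C → ∀ k, P (mutate C k)) :
    ∀ C ∈ mutationClass B, P C := by
  rintro C ⟨l, rfl⟩
  induction l using List.reverseRecOn with
  | nil => exact h0
  | append_singleton l k ih =>
    simp only [List.foldl_append, List.foldl_cons, List.foldl_nil]
    exact hs _ ⟨l, rfl⟩ ih k

/-- Oriented non-isosceles cycle. -/
def NI (B : Matrix (Fin n) (Fin n) ℤ) (i j k : Fin n) : Prop :=
  (i ≠ j ∧ j ≠ k ∧ i ≠ k) ∧ (0 < B i j ∧ 0 < B j k ∧ 0 < B k i) ∧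
  B i j * B j i ≠ B j k * B k j ∧ B j k * B k j ≠ B k i * B i k ∧ B i j * B j i ≠ B k i * B i k

lemma NI.rot {i j k : Fin n} (h : NI B i j k) : NI B j k i := by
  obtain ⟨⟨a, b, c⟩, ⟨e, f, g⟩, x, y, z⟩ := h
  exact ⟨⟨b, c.symm, a.symm⟩, ⟨f, g, e⟩, y, z.symm, x.symm⟩

def wsum (B : Matrix (Fin n) (Fin n) ℤ) (i j k : Fin n) : ℤ :=
  -(B i j * B j i) - B j k * B k j - B k i * B i k

lemma grow_aux (X Y Z P : ℤ) (hZ : 1 ≤ Z) (hY : Z < Y) (hX : Y < X) (hP : P ^ 2 = X * Y * Z) :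
    X < X * Y + Z - 2 * P := by
  suffices h : 2 * P < X * (Y - 1) + Z by linarith
  apply lt_of_pow_lt_pow_left₀ 2 (by nlinarith)
  have e : (2 * P) ^ 2 = 4 * (X * Y * Z) := by rw [← hP]; ring
  rw [e]
  by_cases h4 : 4 ≤ Y
  · obtain ⟨u, rfl⟩ : ∃ u, X = Z + u := ⟨X - Z, by ring⟩
    have hu : 0 < u := by linarith
    have a1 : 0 ≤ Z ^ 2 * (Y * (Y - 4)) := by
      apply mul_nonneg (by positivity); apply mul_nonneg <;> linarith
    have a2 : 0 ≤ u * Z * (Y * (Y - 3)) := by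
      apply mul_nonneg (mul_nonneg hu.le (by linarith)); apply mul_nonneg <;> linarith
    have a3 : 0 < u ^ 2 * (Y - 1) ^ 2 := by
      have : 0 < Y - 1 := by linarith
      positivity
    nlinarith
  · have : Y = 2 ∨ Y = 3 := by omega
    rcases this with rfl | rfl
    · obtain rfl : Z = 1 := by omega
      by_cases h6 : 6 ≤ X
      · nlinarith
      · exfalso
        have b1 : P < 4 := by nlinarith
        have b2 : -4 < P := by nlinarith
        interval_cases P <;> omega
    · have : Z = 1 ∨ Z = 2 := by omega
      rcases this with rfl | rfl <;> nlinarith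

lemma grow_step (h : SSd d B) {i j k : Fin n} (hN : NI B i j k)
    (h1 : B i j * B j i < B k i * B i k) (h2 : B j k * B k j < B k i * B i k) :
    NI (mutate B j) k j i ∧ wsum B i j k < wsum (mutate B j) k j i := by
  obtain ⟨⟨hij, hjk, hik⟩, ⟨pa, pb, pc⟩, x, y, z⟩ := hN
  have na := h.neg pa
  have nb := h.neg pb
  have nc := h.neg pc
  have tri := h.tri i j k
  have m1 : mutate B j i k = B i k + B i j * B j k := mut_pos hij hjk.symm pa pb
  have m2 : mutate B j k i = B k i - B k j * B j i := mut_neg hjk.symm hij nb na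
  simp only [NI, wsum, m1, m2, mut_l, mut_r]
  generalize B i j = a at *
  generalize B j k = b at *
  generalize B k i = c at *
  generalize B j i = xa at *
  obtain ⟨a', rfl⟩ : ∃ t, xa = -t := ⟨-xa, by ring⟩
  generalize B k j = xb at *
  obtain ⟨b', rfl⟩ : ∃ t, xb = -t := ⟨-xb, by ring⟩
  generalize B i k = xc at *
  obtain ⟨c', rfl⟩ : ∃ t, xc = -t := ⟨-xc, by ring⟩
  clear m1 m2
  have pa' : 0 < a' := by linarith
  have pb' : 0 < b' := by linarith
  have pc' : 0 < c' := by linarith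
  have tri' : a * b * c = a' * b' * c' := by linarith
  obtain ⟨X, hX⟩ : ∃ t, t = a * a' := ⟨_, rfl⟩
  obtain ⟨Y, hY⟩ : ∃ t, t = b * b' := ⟨_, rfl⟩
  obtain ⟨Z, hZ⟩ : ∃ t, t = c * c' := ⟨_, rfl⟩
  obtain ⟨P, hP⟩ : ∃ t, t = a * b * c := ⟨_, rfl⟩
  have hPP : P ^ 2 = X * Y * Z := by
    calc P ^ 2 = (a * b * c) * (a' * b' * c') := by rw [← tri', ← hP]; ring
      _ = _ := by rw [hX, hY, hZ]; ring
  have Zp : 1 ≤ Z := by have := mul_pos pc pc'; omega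
  have ZX : Z < X := by linarith
  have ZY : Z < Y := by linarith
  have XY : X ≠ Y := by intro e; apply x; linarith
  have Pp : 0 < P := by rw [hP]; positivity
  have PZ : Z < P := by
    have : Z ^ 2 < P ^ 2 := by
      rw [hPP]
      have : Z * 1 < X * Y := by nlinarith
      nlinarith
    exact lt_of_pow_lt_pow_left₀ 2 Pp.le this
  have W : X < X * Y + Z - 2 * P ∧ Y < X * Y + Z - 2 * P := by
    rcases lt_or_gt_of_ne XY with hl | hl
    · have := grow_aux Y X Z P Zp ZX hl (by rw [hPP]; ring)
      constructor <;> nlinarith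
    · have := grow_aux X Y Z P Zp ZY hl hPP
      constructor <;> linarith
  have eW : (-c' + a * b) * (c - -b' * -a') = -(X * Y + Z - 2 * P) := by
    have : (-c' + a * b) * (c - -b' * -a') =
      -(a * a' * (b * b') + c * c' - a * b * c - a' * b' * c') := by ring
    rw [this, ← tri', ← hX, ← hY, ← hZ, ← hP]; ring
  have eW' : (c - -b' * -a') * (-c' + a * b) = -(X * Y + Z - 2 * P) := by rw [mul_comm, eW]
  have pW : 0 < -c' + a * b := by
    by_contra hcon
    have : (a * b) * c ≤ c' * c := mul_le_mul_of_nonneg_right (by linarith) pc.le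
    linarith
  refine ⟨⟨⟨hjk.symm, hij.symm, hik.symm⟩, ⟨by linarith, by linarith, pW⟩, ?_, ?_, ?_⟩, ?_⟩
  · intro e; apply XY; linarith
  · rw [eW]; intro e; linarith
  · rw [eW]; intro e; linarith
  · rw [eW]; linarith

lemma wsum_rot (i j k : Fin n) : wsum B j k i = wsum B i j k := by
  unfold wsum; ring

lemma grow (h : SSd d B) {i j k : Fin n} (hN : NI B i j k) :
    ∃ l i' j' k', NI (mutate B l) i' j' k' ∧ wsum B i j k < wsum (mutate B l) i' j' k' := by
  have hN' := hN
  obtain ⟨-, -, x, y, z⟩ := hN'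
  by_cases c1 : B i j * B j i < B k i * B i k ∧ B j k * B k j < B k i * B i k
  · exact ⟨_, _, _, _, grow_step h hN c1.1 c1.2⟩
  by_cases c2 : B j k * B k j < B i j * B j i ∧ B k i * B i k < B i j * B j i
  · have := grow_step h hN.rot c2.1 c2.2
    rw [wsum_rot] at this
    exact ⟨_, _, _, _, this⟩
  have := grow_step h hN.rot.rot (by omega) (by omega)
  rw [wsum_rot, wsum_rot] at this
  exact ⟨_, _, _, _, this⟩

lemma class_SSd (h : SSd d B) : ∀ C ∈ mutationClass B, SSd d C :=
  class_ind (SSd d) h (fun _ _ hC k => hC.mutate k)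

lemma infinite_of_NI (h : SSd d B) {C : Matrix (Fin n) (Fin n) ℤ} (hC : C ∈ mutationClass B)
    {i j k : Fin n} (hN : NI C i j k) : (mutationClass B).Infinite := by
  intro hf
  let S : Set (Matrix (Fin n) (Fin n) ℤ × Fin n × Fin n × Fin n) :=
    {p | p.1 ∈ mutationClass B ∧ NI p.1 p.2.1 p.2.2.1 p.2.2.2}
  have hS : S.Finite :=
    (hf.prod (Set.finite_univ (α := Fin n × Fin n × Fin n))).subset
      (fun p hp => ⟨hp.1, Set.mem_univ _⟩)
  obtain ⟨p, hp, hmax⟩ := Set.exists_max_image S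
    (fun p => wsum p.1 p.2.1 p.2.2.1 p.2.2.2) hS ⟨(C, i, j, k), hC, hN⟩
  obtain ⟨l, i', j', k', h1, h2⟩ := grow (class_SSd h _ hp.1) hp.2
  have := hmax (mutate p.1 l, i', j', k') ⟨class_mutate hp.1 l, h1⟩
  exact absurd h2 (not_lt.mpr this)

lemma cyc_case (h : SSd d B) {i j k : Fin n} (hij : i ≠ j) (hjk : j ≠ k) (hik : i ≠ k)
    (pa : 0 < B i k) (pb : 0 < B k j) (pc : 0 < B j i)
    (e : B i k * B k i = B k j * B j k) (h4 : 4 < -(B j i * B i j))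
    (hX : -(B i k * B k i) < -(B j i * B i j)) :
    NI (mutate B i) i j k := by
  have na := h.neg pa
  have nb := h.neg pb
  have nc := h.neg pc
  have tri := h.tri i k j
  have m1 : mutate B i j k = B j k + B j i * B i k := mut_pos hij.symm hik.symm pc pa
  have m2 : mutate B i k j = B k j - B k i * B i j := mut_neg hik.symm hij.symm na nc
  simp only [NI, m1, m2, mut_l, mut_r]
  generalize B i k = a at *
  generalize B k j = b at *
  generalize B j i = c at *
  generalize B k i = xa at *
  obtain ⟨a', rfl⟩ : ∃ t, xa = -t := ⟨-xa, by ring⟩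
  generalize B j k = xb at *
  obtain ⟨b', rfl⟩ : ∃ t, xb = -t := ⟨-xb, by ring⟩
  generalize B i j = xc at *
  obtain ⟨c', rfl⟩ : ∃ t, xc = -t := ⟨-xc, by ring⟩
  clear m1 m2
  have pa' : 0 < a' := by linarith
  have pb' : 0 < b' := by linarith
  have pc' : 0 < c' := by linarith
  have tri' : a * b * c = a' * b' * c' := by linarith
  have e' : a * a' = b * b' := by linarith
  obtain ⟨X, hX'⟩ : ∃ t, t = a * a' := ⟨_, rfl⟩
  obtain ⟨Z, hZ⟩ : ∃ t, t = c * c' := ⟨_, rfl⟩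
  obtain ⟨P, hP⟩ : ∃ t, t = a * b * c := ⟨_, rfl⟩
  have Xp : 0 < X := by rw [hX']; positivity
  have Pp : 0 < P := by rw [hP]; positivity
  have hPP : P ^ 2 = X ^ 2 * Z := by
    calc P ^ 2 = (a * b * c) * (a' * b' * c') := by rw [← tri', ← hP]; ring
      _ = (a * a') * (b * b') * (c * c') := by ring
      _ = _ := by rw [← e', ← hX', ← hZ]; ring
  obtain ⟨s, hs⟩ : X ∣ P := by
    rw [← Int.pow_dvd_pow_iff (n := 2) (by norm_num)]; exact ⟨Z, hPP⟩
  have hsZ : Z = s ^ 2 := by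
    have : X ^ 2 * Z = X ^ 2 * s ^ 2 := by rw [← hPP, hs]; ring
    exact mul_left_cancel₀ (by positivity) this
  have sp : 0 < s := by
    by_contra hc
    have : X * s ≤ 0 := mul_nonpos_of_nonneg_of_nonpos Xp.le (not_lt.mp hc)
    linarith
  have s3 : 3 ≤ s := by
    have : 4 < s ^ 2 := by linarith
    nlinarith
  have eW : (-b' + c * a) * (b - -a' * -c') = -(X * (s - 1) ^ 2) := by
    have : (-b' + c * a) * (b - -a' * -c') =
      -(a * a' * (c * c') + b * b' - a * b * c - a' * b' * c') := by ring
    rw [this, ← tri', ← e', ← hX', ← hZ, ← hP, hs, hsZ]; ring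
  have pW : 0 < -b' + c * a := by
    by_contra hcon
    have : (c * a) * b ≤ b' * b := mul_le_mul_of_nonneg_right (by linarith) pb.le
    nlinarith
  have hne : X * (s - 1) ^ 2 ≠ s ^ 2 := by
    intro hh
    have : (s - 1) ∣ s := by
      rw [← Int.pow_dvd_pow_iff (n := 2) (by norm_num)]; exact ⟨X, by rw [← hh]; ring⟩
    have h1 : (s - 1) ∣ 1 := by
      have := dvd_sub this (dvd_refl (s - 1))
      simpa using this
    have := Int.le_of_dvd (by norm_num) h1
    omega
  refine ⟨⟨hij, hjk, hik⟩, ⟨by linarith, pW, by linarith⟩, ?_, ?_, ?_⟩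
  · rw [eW]; intro hh; apply hne; linarith
  · rw [eW]; intro hh; nlinarith
  · intro hh; linarith

lemma acyc_case (h : SSd d B) {i j k : Fin n} (hij : i ≠ j) (hjk : j ≠ k) (hik : i ≠ k)
    (pa : 0 < B i k) (pb : 0 < B k j) (pc : 0 < B i j)
    (hX : -(B i k * B k i) < -(B i j * B j i)) :
    NI (mutate (mutate B j) i) i j k := by
  have na := h.neg pa
  have nb := h.neg pb
  have nc := h.neg pc
  have z1 : mutate B j i k = B i k := mut_zero hij hjk.symm (by nlinarith)
  have z2 : mutate B j k i = B k i := mut_zero hjk.symm hij (by nlinarith)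
  have m1 : mutate (mutate B j) i j k = mutate B j j k + mutate B j j i * mutate B j i k :=
    mut_pos hij.symm hik.symm (by rw [mut_l]; linarith) (by rw [z1]; exact pa)
  have m2 : mutate (mutate B j) i k j = mutate B j k j - mutate B j k i * mutate B j i j :=
    mut_neg hik.symm hij.symm (by rw [z2]; exact na) (by rw [mut_r]; linarith)
  have l1 : mutate (mutate B j) i i j = B i j := by rw [mut_l, mut_r, neg_neg]
  have l2 : mutate (mutate B j) i j i = B j i := by rw [mut_r, mut_l, neg_neg]
  have l3 : mutate (mutate B j) i i k = -B i k := by rw [mut_l, z1]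
  have l4 : mutate (mutate B j) i k i = -B k i := by rw [mut_r, z2]
  rw [mut_l, mut_l, z1] at m1
  rw [mut_r, mut_r, z2] at m2
  simp only [NI, m1, m2, l1, l2, l3, l4]
  generalize B i k = a at *
  generalize B k j = b at *
  generalize B i j = c at *
  generalize B k i = xa at *
  obtain ⟨a', rfl⟩ : ∃ t, xa = -t := ⟨-xa, by ring⟩
  generalize B j k = xb at *
  obtain ⟨b', rfl⟩ : ∃ t, xb = -t := ⟨-xb, by ring⟩
  generalize B j i = xc at *
  obtain ⟨c', rfl⟩ : ∃ t, xc = -t := ⟨-xc, by ring⟩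
  clear m1 m2
  have pa' : 0 < a' := by linarith
  have pb' : 0 < b' := by linarith
  have pc' : 0 < c' := by linarith
  have XZ : a * a' < c * c' := by linarith
  have big : (a * a') * (c * c') < (b' + c' * a) * (b + a' * c) := by
    have : 0 < b' * b + b' * (a' * c) + c' * a * b := by positivity
    nlinarith
  have Xp : 0 < a * a' := by positivity
  have Zp : 0 < c * c' := by positivity
  have big2 : c * c' < (b' + c' * a) * (b + a' * c) := by nlinarith
  refine ⟨⟨hij, hjk, hik⟩, ⟨pc, by nlinarith, by linarith⟩, ?_, ?_, ?_⟩
  · intro hh; nlinarith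
  · intro hh; nlinarith
  · intro hh; nlinarith

lemma key {C : Matrix (Fin n) (Fin n) ℤ} (h : SSd d C) (hC : C ∈ mutationClass B) {M : ℤ}
    (hM : 4 ≤ M)
    {i j k : Fin n} (hij : i ≠ j) (hjk : j ≠ k) (hik : i ≠ k)
    (pa : 0 < C i k) (pb : 0 < C k j) (h1 : -(C i k * C k i) ≤ M) (h2 : -(C k j * C j k) ≤ M)
    (h3 : M < -(C i j * C j i)) :
    ∃ D ∈ mutationClass B, ∃ i j k, NI D i j k := by
  have hcomm : C j i * C i j = C i j * C j i := mul_comm _ _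
  rcases lt_trichotomy (C i j) 0 with hc | hc | hc
  · by_cases e : C i k * C k i = C k j * C j k
    · exact ⟨_, class_mutate hC i, i, j, k,
        cyc_case h hij hjk hik pa pb (h.pos hc) e (by linarith) (by linarith)⟩
    · refine ⟨C, hC, i, k, j, ⟨hik, hjk.symm, hij⟩, ⟨pa, pb, h.pos hc⟩, e, ?_, ?_⟩
      · intro hh; linarith
      · intro hh; linarith
  · rw [hc] at h3; linarith
  · exact ⟨_, class_mutate (class_mutate hC j) i, i, j, k,
      acyc_case h hij hjk hik pa pb hc (by linarith)⟩

lemma bounded (h : SSd d B) (hno : ¬ ∃ D ∈ mutationClass B, ∃ i j k, NI D i j k) {M : ℤ}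
    (hM : 4 ≤ M) (h0 : ∀ i j, -(B i j * B j i) ≤ M) :
    ∀ C ∈ mutationClass B, ∀ i j, -(C i j * C j i) ≤ M := by
  apply class_ind (fun C => ∀ i j, -(C i j * C j i) ≤ M) h0
  intro C hC ih k i j
  have hs := class_SSd h C hC
  by_cases hi : i = k
  · subst hi; rw [mut_l, mut_r]; have := ih i j; linarith
  by_cases hj : j = k
  · subst hj; rw [mut_l, mut_r]; have := ih i j; linarith
  by_cases hp : C i k * C k j ≤ 0
  · rw [mut_zero hi hj hp, mut_zero hj hi (hs.nonpos hp)]; exact ih i j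
  by_contra hcon
  rw [not_le] at hcon
  have hs' := hs.mutate k
  have hij : i ≠ j := by
    rintro rfl
    have := mul_self_nonneg (mutate C k i i)
    linarith
  have w1 := ih i k
  have w2 := ih k j
  apply hno
  rcases mul_pos_iff.mp (not_le.mp hp) with ⟨h1, h2⟩ | ⟨h1, h2⟩
  · have n1 := hs.neg h1
    have n2 := hs.neg h2
    apply key hs' (class_mutate hC k) hM hij.symm hi hj
    · rw [mut_r]; linarith
    · rw [mut_l]; linarith
    · rw [mut_l, mut_r]; linarith
    · rw [mut_l, mut_r]; linarith
    · linarith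
  · apply key hs' (class_mutate hC k) hM hij hj hi
    · rw [mut_r]; linarith
    · rw [mut_l]; linarith
    · rw [mut_l, mut_r]; linarith
    · rw [mut_l, mut_r]; linarith
    · linarith

lemma finite_of_not (h : SSd d B) (hno : ¬ ∃ D ∈ mutationClass B, ∃ i j k, NI D i j k) :
    (mutationClass B).Finite := by
  obtain ⟨M, hM, h0⟩ : ∃ M : ℤ, 4 ≤ M ∧ ∀ i j, -(B i j * B j i) ≤ M := by
    obtain ⟨M, hM⟩ := (Set.finite_range
      (fun p : Fin n × Fin n => -(B p.1 p.2 * B p.2 p.1))).bddAbove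
    exact ⟨max 4 M, le_max_left _ _, fun i j => le_max_of_le_right (hM ⟨(i, j), rfl⟩)⟩
  have hb := bounded h hno hM h0
  have hfin : (Set.pi Set.univ (fun _ : Fin n => Set.pi Set.univ
      (fun _ : Fin n => Set.Icc (-M) M))).Finite :=
    Set.Finite.pi fun _ => Set.Finite.pi fun _ => Set.finite_Icc _ _
  refine hfin.subset (fun C hC i _ j _ => ?_)
  have hs := class_SSd h C hC
  have w := hb C hC i j
  rcases lt_trichotomy (C i j) 0 with hc | hc | hc
  · have := hs.pos hc
    constructor <;> nlinarith
  · constructor <;> linarith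
  · have := hs.neg hc
    constructor <;> nlinarith

lemma NI_iff (h : SSd d B) (i j k : Fin n) : NI B i j k ↔
    i ≠ j ∧ j ≠ k ∧ i ≠ k ∧
        0 < B i j ∧ 0 < B j k ∧ 0 < B k i ∧
        (B i j * B j i).natAbs ≠ (B j k * B k j).natAbs ∧
        (B j k * B k j).natAbs ≠ (B k i * B i k).natAbs ∧
        (B i j * B j i).natAbs ≠ (B k i * B i k).natAbs := by
  have np : ∀ i j, 0 < B i j → B i j * B j i < 0 := fun i j hp =>
    mul_neg_of_pos_of_neg hp (h.neg hp)
  have e : ∀ x y : ℤ, x < 0 → y < 0 → (x.natAbs = y.natAbs ↔ x = y) := by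
    intro x y _ _; omega
  unfold NI
  constructor
  · rintro ⟨⟨a, b, c⟩, ⟨p, q, r⟩, x, y, z⟩
    refine ⟨a, b, c, p, q, r, ?_, ?_, ?_⟩ <;> rw [Ne, e _ _ (np _ _ ‹_›) (np _ _ ‹_›)] <;>
      assumption
  · rintro ⟨a, b, c, p, q, r, x, y, z⟩
    rw [Ne, e _ _ (np _ _ ‹_›) (np _ _ ‹_›)] at x y z
    exact ⟨⟨a, b, c⟩, ⟨p, q, r⟩, x, y, z⟩

end MutHelpers

/-- Lemma 3.6, (1) ⇔ (4): the mutation class of a skew-symmetrizable matrix `B` is infinite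
iff some `B' ∈ [B]` contains an oriented 3-cycle whose three edge weights are pairwise
distinct (i.e. a 3-cycle that is not isosceles). -/
theorem mutation_class_infinite_iff_non_isosceles_cycle (n : ℕ) (hn : 1 ≤ n)
    (B : Matrix (Fin n) (Fin n) ℤ) (hB : IsSkewSymmetrizable B) :
    (mutationClass B).Infinite ↔
      ∃ B' ∈ mutationClass B, ∃ i j k : Fin n,
        i ≠ j ∧ j ≠ k ∧ i ≠ k ∧
        0 < B' i j ∧ 0 < B' j k ∧ 0 < B' k i ∧
        (B' i j * B' j i).natAbs ≠ (B' j k * B' k j).natAbs ∧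
        (B' j k * B' k j).natAbs ≠ (B' k i * B' i k).natAbs ∧
        (B' i j * B' j i).natAbs ≠ (B' k i * B' i k).natAbs := by
  obtain ⟨d, hd⟩ := hB
  have h : SSd d B := hd
  constructor
  · intro hinf
    by_contra hno
    apply hinf
    apply finite_of_not h
    rintro ⟨D, hD, i, j, k, hN⟩
    exact hno ⟨D, hD, i, j, k, (NI_iff (class_SSd h D hD) i j k).mp hN⟩
  · rintro ⟨D, hD, i, j, k, hN⟩
    exact infinite_of_NI h hD ((NI_iff (class_SSd h D hD) i j k).mpr hN)
end

section
/- (Example 3.3(3): a rigid vertex) Let B₀ be the 3×3 integer matrix with rows (0, 2, −2), (−1, 0, 2), (1, −2, 0); B₀ is skew-symmetrizable (with symmetrizer d = (1, 2, 2)) and its quiver is an oriented 3-cycle with edge weights 2, 4, 2. Then the cluster variable (u₂ + u₃)/u₁, obtained by mutating the initial seed of B₀ at index 1, is not a symmetric cluster variable of B₀; in particular ℬ(B₀) is a proper ℤ-subalgebra of 𝒜(B₀). -/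
/-- The ambient field `F = ℚ(u₁, …, uₙ)`. -/
abbrev ClusterField (n : ℕ) := FractionRing (MvPolynomial (Fin n) ℚ)

/-- A seed: an `n`-tuple of elements of `F` together with an integer matrix. -/
abbrev Seed (n : ℕ) := (Fin n → ClusterField n) × Matrix (Fin n) (Fin n) ℤ

/-- The exchange expression `(∏_{B j k > 0} X j ^ (B j k) + ∏_{B j k < 0} X j ^ (-B j k)) / X k`. -/
noncomputable def exchange {n : ℕ} (X : Fin n → ClusterField n) (B : Matrix (Fin n) (Fin n) ℤ)
    (k : Fin n) : ClusterField n :=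
  ((∏ j, if 0 < B j k then X j ^ (B j k).toNat else 1) +
   (∏ j, if B j k < 0 then X j ^ (-(B j k)).toNat else 1)) / X k

/-- Seed mutation in direction `k`. -/
noncomputable def seedMutate {n : ℕ} (s : Seed n) (k : Fin n) : Seed n :=
  (fun i => if i = k then exchange s.1 s.2 k else s.1 i, mutate s.2 k)

/-- The initial seed `(u, B)`. -/
noncomputable def initialSeed {n : ℕ} (B : Matrix (Fin n) (Fin n) ℤ) : Seed n :=
  (fun i => algebraMap (MvPolynomial (Fin n) ℚ) (ClusterField n) (MvPolynomial.X i), B)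

/-- The set of cluster variables of `B`: coordinates of seeds reachable from the initial seed. -/
def clusterVars {n : ℕ} (B : Matrix (Fin n) (Fin n) ℤ) : Set (ClusterField n) :=
  {x | ∃ (l : List (Fin n)) (i : Fin n), x = (l.foldl seedMutate (initialSeed B)).1 i}

/-- The set of symmetric cluster variables of `B`: coordinates of reachable seeds whose
matrix is `σ·B` for some permutation `σ`. -/
def symClusterVars {n : ℕ} (B : Matrix (Fin n) (Fin n) ℤ) : Set (ClusterField n) :=
  {x | ∃ (l : List (Fin n)) (i : Fin n) (σ : Equiv.Perm (Fin n)),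
      (l.foldl seedMutate (initialSeed B)).2 = permMat σ B ∧
      x = (l.foldl seedMutate (initialSeed B)).1 i}

/-- The cluster algebra `𝒜(B)`: the ℤ-subalgebra of `F` generated by all cluster variables. -/
noncomputable def clusterAlgebra {n : ℕ} (B : Matrix (Fin n) (Fin n) ℤ) :
    Subalgebra ℤ (ClusterField n) :=
  Algebra.adjoin ℤ (clusterVars B)

/-- The symmetric mutation subalgebra `ℬ(B)`: the ℤ-subalgebra of `F` generated by all
symmetric cluster variables. -/
noncomputable def symMutationAlgebra {n : ℕ} (B : Matrix (Fin n) (Fin n) ℤ) :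
    Subalgebra ℤ (ClusterField n) :=
  Algebra.adjoin ℤ (symClusterVars B)

/-- The matrix of Example 3.3(3): an oriented 3-cycle with edge weights 2, 4, 2 and a
rigid vertex at index 1. -/
def rigidExample : Matrix (Fin 3) (Fin 3) ℤ :=
  !![0, 2, -2; -1, 0, 2; 1, -2, 0]


namespace RigidAux

open Polynomial

noncomputable abbrev uu (i : Fin 3) : ClusterField 3 :=
  algebraMap (MvPolynomial (Fin 3) ℚ) (ClusterField 3) (MvPolynomial.X i)

noncomputable def ev (t : ℚ) : MvPolynomial (Fin 3) ℚ →+* ℚ[X] :=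
  (MvPolynomial.aeval (![X, 1, -1 + C t * X] : Fin 3 → ℚ[X])).toRingHom

/-- `f` has value `c` at the place `t`. -/
def V (t : ℚ) (f : ClusterField 3) (c : ℚ) : Prop :=
  ∃ (p q : MvPolynomial (Fin 3) ℚ) (k : ℕ) (p1 q1 : ℚ[X]),
    ev t p = X ^ k * p1 ∧ ev t q = X ^ k * q1 ∧ q1.eval 0 ≠ 0 ∧
    p1.eval 0 = c * q1.eval 0 ∧
    f * algebraMap _ (ClusterField 3) q = algebraMap _ (ClusterField 3) p

lemma ev0 (t : ℚ) : ev t (MvPolynomial.X 0) = X := by simp [ev]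
lemma ev1 (t : ℚ) : ev t (MvPolynomial.X 1) = 1 := by simp [ev]
lemma ev2 (t : ℚ) : ev t (MvPolynomial.X 2) = -1 + C t * X := by simp [ev]

lemma V.add {t f g c d} (hf : V t f c) (hg : V t g d) : V t (f + g) (c + d) := by
  obtain ⟨p, q, k, p1, q1, h1, h2, h3, h4, h5⟩ := hf
  obtain ⟨p', q', k', p1', q1', h1', h2', h3', h4', h5'⟩ := hg
  refine ⟨p * q' + p' * q, q * q', k + k', p1 * q1' + p1' * q1, q1 * q1', ?_, ?_, ?_, ?_, ?_⟩
  · simp only [map_add, map_mul, h1, h2, h1', h2']; ring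
  · simp only [map_mul, h2, h2']; ring
  · simp [h3, h3']
  · simp only [eval_add, eval_mul, h4, h4']; ring
  · simp only [map_add, map_mul, ← h5, ← h5']; ring

lemma V.mul {t f g c d} (hf : V t f c) (hg : V t g d) : V t (f * g) (c * d) := by
  obtain ⟨p, q, k, p1, q1, h1, h2, h3, h4, h5⟩ := hf
  obtain ⟨p', q', k', p1', q1', h1', h2', h3', h4', h5'⟩ := hg
  refine ⟨p * p', q * q', k + k', p1 * p1', q1 * q1', ?_, ?_, ?_, ?_, ?_⟩
  · simp only [map_mul, h1, h1']; ring
  · simp only [map_mul, h2, h2']; ring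
  · simp [h3, h3']
  · simp only [eval_mul, h4, h4']; ring
  · simp only [map_mul, ← h5, ← h5']; ring

lemma V.int (t : ℚ) (r : ℤ) : V t (r : ClusterField 3) r :=
  ⟨(r : MvPolynomial (Fin 3) ℚ), 1, 0, (r : ℚ[X]), 1, by simp, by simp, by simp, by simp, by simp⟩

lemma V.uniq {t f c d} (hf : V t f c) (hg : V t f d) : c = d := by
  obtain ⟨p, q, k, p1, q1, h1, h2, h3, h4, h5⟩ := hf
  obtain ⟨p', q', k', p1', q1', h1', h2', h3', h4', h5'⟩ := hg
  have h : p * q' = p' * q := by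
    apply IsFractionRing.injective (MvPolynomial (Fin 3) ℚ) (ClusterField 3)
    simp only [map_mul, ← h5, ← h5']; ring
  have h' := congrArg (ev t) h
  simp only [map_mul, h1, h1', h2, h2'] at h'
  have h'' : p1 * q1' = p1' * q1 := by
    apply mul_left_cancel₀ (pow_ne_zero (k + k') (X_ne_zero (R := ℚ)))
    rw [pow_add]; linear_combination h'
  have := congrArg (Polynomial.eval 0) h''
  simp only [eval_mul, h4, h4'] at this
  have h6 : (c - d) * (q1.eval 0 * q1'.eval 0) = 0 := by linear_combination this
  have := (mul_eq_zero.1 h6).resolve_right (mul_ne_zero h3 h3')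
  linarith

lemma V.ne {t f c} (hf : V t f c) (hc : c ≠ 0) : f ≠ 0 := by
  rintro rfl
  have := V.int t 0
  simp only [Int.cast_zero] at this
  exact hc (hf.uniq this)

lemma V.inv {t f c} (hf : V t f c) (hc : c ≠ 0) : V t f⁻¹ c⁻¹ := by
  have hn := hf.ne hc
  obtain ⟨p, q, k, p1, q1, h1, h2, h3, h4, h5⟩ := hf
  refine ⟨q, p, k, q1, p1, h2, h1, ?_, ?_, ?_⟩
  · rw [h4]; exact mul_ne_zero hc h3
  · rw [h4]; field_simp
  · rw [← h5]; field_simp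

lemma V.neg {t f c} (hf : V t f c) : V t (-f) (-c) := by
  have := (V.int t (-1)).mul hf
  simpa using this

lemma u_ne (i : Fin 3) : uu i ≠ 0 := by
  simp [uu]

noncomputable abbrev yy : ClusterField 3 := (uu 1 + uu 2) / uu 0

noncomputable def kk : ClusterField 3 := (yy ^ 2 + 1) / (uu 1 * uu 2)

lemma V0 (t) : V t (uu 0) 0 :=
  ⟨MvPolynomial.X 0, 1, 0, X, 1, by simp [ev0], by simp, by simp, by simp, by simp⟩
lemma V1 (t) : V t (uu 1) 1 :=
  ⟨MvPolynomial.X 1, 1, 0, 1, 1, by simp [ev1], by simp, by simp, by simp, by simp⟩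
lemma V2 (t) : V t (uu 2) (-1) :=
  ⟨MvPolynomial.X 2, 1, 0, -1 + C t * X, 1, by simp [ev2], by simp, by simp, by simp, by simp⟩
lemma Vy (t) : V t yy t := by
  refine ⟨MvPolynomial.X 1 + MvPolynomial.X 2, MvPolynomial.X 0, 1, C t, 1,
    ?_, ?_, by simp, by simp, ?_⟩
  · simp only [map_add, ev1, ev2]; ring
  · simp [ev0]
  · rw [map_add, div_mul_cancel₀ _ (u_ne 0)]

lemma Vk (t) (ht : t ^ 2 = 1) : V t kk (-2) := by
  have h := (((Vy t).mul (Vy t)).add (V.int t 1)).mul (((V1 t).mul (V2 t)).inv (by norm_num))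
  have e1 : (yy * yy + ((1 : ℤ) : ClusterField 3)) * (uu 1 * uu 2)⁻¹ = kk := by
    rw [kk, div_eq_mul_inv, pow_two]; simp
  have e2 : (t * t + ((1 : ℤ) : ℚ)) * (1 * (-1))⁻¹ = -2 := by
    rw [← pow_two, ht]; norm_num
  rw [e1, e2] at h
  exact h

def W (f : ClusterField 3) (c : ℚ) : Prop := V 1 f c ∧ V (-1) f c

lemma Wk : W kk (-2) := ⟨Vk _ (by norm_num), Vk _ (by norm_num)⟩
lemma W.add {f g c d} (hf : W f c) (hg : W g d) : W (f + g) (c + d) :=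
  ⟨hf.1.add hg.1, hf.2.add hg.2⟩
lemma W.mul {f g c d} (hf : W f c) (hg : W g d) : W (f * g) (c * d) :=
  ⟨hf.1.mul hg.1, hf.2.mul hg.2⟩
lemma W.neg {f c} (hf : W f c) : W (-f) (-c) := ⟨hf.1.neg, hf.2.neg⟩
lemma W.int (r : ℤ) : W (r : ClusterField 3) r := ⟨V.int _ r, V.int _ r⟩
lemma W0 : W (uu 0) 0 := ⟨V0 _, V0 _⟩

/-- The pairs of consecutive variables. -/
def P (a b : ClusterField 3) : Prop :=
  ∃ s : ℚ, s ^ 2 = 1 ∧ W a s ∧ W b (-s) ∧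
    (a + b) ^ 2 + uu 0 ^ 2 = kk * uu 0 ^ 2 * a * b

lemma P.symm {a b} (h : P a b) : P b a := by
  obtain ⟨s, hs, ha, hb, h⟩ := h
  refine ⟨-s, by simpa using hs, hb, by simpa using ha, ?_⟩
  linear_combination h

lemma P.init : P (uu 1) (uu 2) := by
  refine ⟨1, by norm_num, ⟨V1 _, V1 _⟩, ⟨V2 _, V2 _⟩, ?_⟩
  have h0 := u_ne 0
  have h1 := u_ne 1
  have h2 := u_ne 2
  rw [kk]
  field_simp

lemma sne {s : ℚ} (h : s ^ 2 = 1) : s ≠ 0 := by rintro rfl; norm_num at h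

lemma P.ne {a b} (h : P a b) : a ≠ 0 := by
  obtain ⟨s, hs, ha, hb, h⟩ := h
  exact ha.1.ne (sne hs)

lemma k_ne : kk ≠ 0 := Wk.1.ne (by norm_num)

lemma P.sum_ne {a b} (h : P a b) : a + b ≠ 0 := by
  obtain ⟨s, hs, ha, hb, h⟩ := h
  intro h0
  have hb' : b = -a := by linear_combination h0
  subst hb'
  have h1 : kk * (a * a) = ((-1 : ℤ) : ClusterField 3) := by
    apply mul_left_cancel₀ (pow_ne_zero 2 (u_ne 0))
    push_cast
    linear_combination h
  have h2 := (Wk.mul (ha.mul ha)).1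
  rw [h1] at h2
  have := h2.uniq (V.int 1 (-1))
  rw [← pow_two, hs] at this
  norm_num at this

/-- next variable after `a, b`. -/
noncomputable def nx (a b : ClusterField 3) : ClusterField 3 := (kk * uu 0 ^ 2 - 2) * b - a

lemma P.next {a b} (h : P a b) : P b (nx a b) := by
  obtain ⟨s, hs, ha, hb, h⟩ := h
  have hW : W (nx a b) (((-2) * (0 * 0) + ((-2 : ℤ) : ℚ)) * (-s) + -s) := by
    have := (((Wk.mul (W0.mul W0)).add (W.int (-2))).mul hb).add ha.neg
    convert this using 1
    rw [nx]; push_cast; ring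
  refine ⟨-s, by simpa using hs, hb, ?_, ?_⟩
  · convert hW using 1; push_cast; ring
  · rw [nx]; linear_combination h

lemma P.ex {a b} (h : P a b) : (uu 0 ^ 2 + b ^ 2) / a = nx a b := by
  have ha := h.ne
  obtain ⟨s, hs, _, hb, h⟩ := h
  rw [div_eq_iff ha, nx]
  linear_combination h

lemma P.y2 {a b} (h : P a b) : ((a + b) / uu 0) ^ 2 + 1 = kk * a * b := by
  obtain ⟨s, hs, _, hb, h⟩ := h
  have := u_ne 0
  field_simp
  linear_combination h

lemma P.yy {a b} (h : P a b) :
    (a * (kk * a) + 1) / ((a + b) / uu 0) = (a + nx b a) / uu 0 := by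
  have h1 := h.sum_ne
  have h0 := u_ne 0
  obtain ⟨s, hs, _, hb, h⟩ := h
  rw [div_eq_iff (div_ne_zero h1 h0), div_mul_div_comm, eq_div_iff (mul_ne_zero h0 h0), nx]
  linear_combination h

def cyc (e : ℤ) : Matrix (Fin 3) (Fin 3) ℤ := !![0, 2*e, -2*e; -e, 0, 2*e; e, -2*e, 0]
def star (s t : ℤ) : Matrix (Fin 3) (Fin 3) ℤ := !![0, 2*s, 2*t; -s, 0, 0; -t, 0, 0]

def sg (e : ℤ) : Prop := e = 1 ∨ e = -1

lemma sg.neg {e} (h : sg e) : sg (-e) := by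
  rcases h with rfl | rfl <;> simp [sg]

lemma cyc_m0 {e} (h : sg e) : mutate (cyc e) 0 = star (-e) e := by
  rcases h with rfl | rfl <;> decide
lemma cyc_m1 {e} (h : sg e) : mutate (cyc e) 1 = cyc (-e) := by
  rcases h with rfl | rfl <;> decide
lemma cyc_m2 {e} (h : sg e) : mutate (cyc e) 2 = cyc (-e) := by
  rcases h with rfl | rfl <;> decide
lemma star_m0 {e} (h : sg e) : mutate (star e e) 0 = star (-e) (-e) := by
  rcases h with rfl | rfl <;> decide
lemma star_m0' {e} (h : sg e) : mutate (star e (-e)) 0 = cyc (-e) := by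
  rcases h with rfl | rfl <;> decide
lemma star_m1 {e f} (h : sg e) (h' : sg f) : mutate (star e f) 1 = star (-e) f := by
  rcases h with rfl | rfl <;> rcases h' with rfl | rfl <;> decide
lemma star_m2 {e f} (h : sg e) (h' : sg f) : mutate (star e f) 2 = star e (-f) := by
  rcases h with rfl | rfl <;> rcases h' with rfl | rfl <;> decide

variable (x y z : ClusterField 3)

lemma sm (x y z : ClusterField 3) (M) :
    seedMutate (![x, y, z], M) 0 = (![exchange ![x, y, z] M 0, y, z], mutate M 0) ∧
    seedMutate (![x, y, z], M) 1 = (![x, exchange ![x, y, z] M 1, z], mutate M 1) ∧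
    seedMutate (![x, y, z], M) 2 = (![x, y, exchange ![x, y, z] M 2], mutate M 2) := by
  refine ⟨?_, ?_, ?_⟩ <;>
  · simp only [seedMutate, Prod.mk.injEq, and_true]
    funext i
    fin_cases i <;> simp

lemma cyc_s0 {e} (h : sg e) :
    seedMutate (![x, y, z], cyc e) 0 = (![(y + z) / x, y, z], star (-e) e) := by
  rw [(sm x y z _).1, cyc_m0 h]
  rcases h with rfl | rfl <;> simp [exchange, cyc, Fin.prod_univ_three, add_comm]
lemma cyc_s1 {e} (h : sg e) :
    seedMutate (![x, y, z], cyc e) 1 = (![x, (x ^ 2 + z ^ 2) / y, z], cyc (-e)) := by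
  rw [(sm x y z _).2.1, cyc_m1 h]
  rcases h with rfl | rfl <;> simp [exchange, cyc, Fin.prod_univ_three, add_comm]
lemma cyc_s2 {e} (h : sg e) :
    seedMutate (![x, y, z], cyc e) 2 = (![x, y, (x ^ 2 + y ^ 2) / z], cyc (-e)) := by
  rw [(sm x y z _).2.2, cyc_m2 h]
  rcases h with rfl | rfl <;> simp [exchange, cyc, Fin.prod_univ_three, add_comm]
lemma star_s0 {e} (h : sg e) :
    seedMutate (![x, y, z], star e e) 0 = (![(y * z + 1) / x, y, z], star (-e) (-e)) := by
  rw [(sm x y z _).1, star_m0 h]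
  rcases h with rfl | rfl <;> simp [exchange, star, Fin.prod_univ_three, add_comm]
lemma star_s0' {e} (h : sg e) :
    seedMutate (![x, y, z], star e (-e)) 0 = (![(y + z) / x, y, z], cyc (-e)) := by
  rw [(sm x y z _).1, star_m0' h]
  rcases h with rfl | rfl <;> simp [exchange, star, Fin.prod_univ_three, add_comm]
lemma star_s1 {e f} (h : sg e) (h' : sg f) :
    seedMutate (![x, y, z], star e f) 1 = (![x, (x ^ 2 + 1) / y, z], star (-e) f) := by
  rw [(sm x y z _).2.1, star_m1 h h']
  rcases h with rfl | rfl <;> simp [exchange, star, Fin.prod_univ_three, add_comm]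
lemma star_s2 {e f} (h : sg e) (h' : sg f) :
    seedMutate (![x, y, z], star e f) 2 = (![x, y, (x ^ 2 + 1) / z], star e (-f)) := by
  rw [(sm x y z _).2.2, star_m2 h h']
  rcases h' with rfl | rfl <;> simp [exchange, star, Fin.prod_univ_three, add_comm]

inductive Inv : Seed 3 → Prop
  | c1 (e : ℤ) (he : sg e) (a b) (h : P a b) : Inv (![uu 0, a, b], cyc e)
  | c2 (e : ℤ) (he : sg e) (a b) (h : P a b) : Inv (![kk * uu 0, kk * a, kk * b], cyc e)
  | o1 (e : ℤ) (he : sg e) (a b) (h : P a b) : Inv (![(a + b) / uu 0, a, b], star e (-e))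
  | o2 (e : ℤ) (he : sg e) (a b) (h : P a b) :
      Inv (![(a + b) / uu 0, kk * a, kk * b], star e (-e))
  | s1 (e : ℤ) (he : sg e) (a b) (h : P a b) : Inv (![(a + b) / uu 0, a, kk * a], star e e)
  | s2 (e : ℤ) (he : sg e) (a b) (h : P a b) : Inv (![(a + b) / uu 0, kk * a, a], star e e)

lemma fin3 (k : Fin 3) : k = 0 ∨ k = 1 ∨ k = 2 := by fin_cases k <;> simp

lemma Inv.step {s} (h : Inv s) (k : Fin 3) : Inv (seedMutate s k) := by
  have h0 := u_ne 0
  have hk := k_ne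
  cases h with
  | c1 e he a b h =>
    rcases fin3 k with rfl | rfl | rfl
    · rw [cyc_s0 _ _ _ he]
      have := Inv.o1 (-e) he.neg a b h
      rwa [neg_neg] at this
    · rw [cyc_s1 _ _ _ he, h.ex]
      exact Inv.c1 _ he.neg _ _ h.next.symm
    · rw [cyc_s2 _ _ _ he, h.symm.ex]
      exact Inv.c1 _ he.neg _ _ h.symm.next
  | c2 e he a b h =>
    have ha := h.ne
    have hb := h.symm.ne
    rcases fin3 k with rfl | rfl | rfl
    · rw [cyc_s0 _ _ _ he, ← mul_add, mul_div_mul_left _ _ hk]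
      have := Inv.o2 (-e) he.neg a b h
      rwa [neg_neg] at this
    · have e1 : ((kk * uu 0) ^ 2 + (kk * b) ^ 2) / (kk * a) = kk * nx a b := by
        rw [← h.ex]; field_simp
      rw [cyc_s1 _ _ _ he, e1]
      exact Inv.c2 _ he.neg _ _ h.next.symm
    · have e1 : ((kk * uu 0) ^ 2 + (kk * a) ^ 2) / (kk * b) = kk * nx b a := by
        rw [← h.symm.ex]; field_simp
      rw [cyc_s2 _ _ _ he, e1]
      exact Inv.c2 _ he.neg _ _ h.symm.next
  | o1 e he a b h =>
    have ha := h.ne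
    have hb := h.symm.ne
    have hs := h.sum_ne
    rcases fin3 k with rfl | rfl | rfl
    · have e1 : (a + b) / ((a + b) / uu 0) = uu 0 := by field_simp
      rw [star_s0' _ _ _ he, e1]
      exact Inv.c1 _ he.neg _ _ h
    · have e1 : kk * a * b / a = kk * b := by field_simp
      rw [star_s1 _ _ _ he he.neg, h.y2, e1, add_comm a b]
      exact Inv.s2 _ he.neg _ _ h.symm
    · have e1 : kk * a * b / b = kk * a := by field_simp
      rw [star_s2 _ _ _ he he.neg, h.y2, e1, neg_neg]
      exact Inv.s1 _ he _ _ h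
  | o2 e he a b h =>
    have ha := h.ne
    have hb := h.symm.ne
    have hs := h.sum_ne
    rcases fin3 k with rfl | rfl | rfl
    · have e1 : (kk * a + kk * b) / ((a + b) / uu 0) = kk * uu 0 := by field_simp
      rw [star_s0' _ _ _ he, e1]
      exact Inv.c2 _ he.neg _ _ h
    · have e1 : kk * a * b / (kk * a) = b := by field_simp
      rw [star_s1 _ _ _ he he.neg, h.y2, e1, add_comm a b]
      exact Inv.s1 _ he.neg _ _ h.symm
    · have e1 : kk * a * b / (kk * b) = a := by field_simp
      rw [star_s2 _ _ _ he he.neg, h.y2, e1, neg_neg]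
      exact Inv.s2 _ he _ _ h
  | s1 e he a b h =>
    have ha := h.ne
    have hb := h.symm.ne
    rcases fin3 k with rfl | rfl | rfl
    · rw [star_s0 _ _ _ he, h.yy]
      exact Inv.s1 _ he.neg _ _ h.symm.next
    · have e1 : kk * a * b / a = kk * b := by field_simp
      rw [star_s1 _ _ _ he he, h.y2, e1, add_comm a b]
      have := Inv.o2 (-e) he.neg _ _ h.symm
      rwa [neg_neg] at this
    · have e1 : kk * a * b / (kk * a) = b := by field_simp
      rw [star_s2 _ _ _ he he, h.y2, e1]
      exact Inv.o1 _ he _ _ h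
  | s2 e he a b h =>
    have ha := h.ne
    have hb := h.symm.ne
    rcases fin3 k with rfl | rfl | rfl
    · rw [star_s0 _ _ _ he, mul_comm (kk * a) a, h.yy]
      exact Inv.s2 _ he.neg _ _ h.symm.next
    · have e1 : kk * a * b / (kk * a) = b := by field_simp
      rw [star_s1 _ _ _ he he, h.y2, e1, add_comm a b]
      have := Inv.o1 (-e) he.neg _ _ h.symm
      rwa [neg_neg] at this
    · have e1 : kk * a * b / a = kk * b := by field_simp
      rw [star_s2 _ _ _ he he, h.y2, e1]
      exact Inv.o2 _ he _ _ h

lemma init_eq : initialSeed rigidExample = (![uu 0, uu 1, uu 2], cyc 1) := by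
  refine Prod.ext ?_ (by decide : rigidExample = cyc 1)
  funext i
  fin_cases i <;> rfl

lemma Inv.reach (l : List (Fin 3)) (s) (h : Inv s) : Inv (l.foldl seedMutate s) := by
  induction l generalizing s with
  | nil => exact h
  | cons k l ih => exact ih _ (h.step k)

lemma star_not (s t : ℤ) (σ : Equiv.Perm (Fin 3)) : star s t ≠ permMat σ rigidExample := by
  intro h
  have h1 := congrFun (congrFun h 1) 2
  have h2 : ∀ i j : Fin 3, i ≠ j → rigidExample i j ≠ 0 := by
    intro i j; fin_cases i <;> fin_cases j <;> simp [rigidExample]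
  refine h2 (σ⁻¹ 1) (σ⁻¹ 2) (fun h => ?_) ?_
  · exact absurd (σ⁻¹.injective h) (by decide)
  · simpa [star, permMat] using h1.symm

lemma W_sym {x} (hx : x ∈ symClusterVars rigidExample) : ∃ c, W x c := by
  obtain ⟨l, i, σ, h1, rfl⟩ := hx
  have hi : Inv (l.foldl seedMutate (initialSeed rigidExample)) := by
    apply Inv.reach
    rw [init_eq]
    exact Inv.c1 1 (Or.inl rfl) _ _ P.init
  generalize l.foldl seedMutate (initialSeed rigidExample) = S at *
  cases hi with
  | c1 e he a b h =>
    obtain ⟨s, -, ha, hb, -⟩ := h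
    rcases fin3 i with rfl | rfl | rfl
    · exact ⟨_, W0⟩
    · exact ⟨_, ha⟩
    · exact ⟨_, hb⟩
  | c2 e he a b h =>
    obtain ⟨s, -, ha, hb, -⟩ := h
    rcases fin3 i with rfl | rfl | rfl
    · exact ⟨_, Wk.mul W0⟩
    · exact ⟨_, Wk.mul ha⟩
    · exact ⟨_, Wk.mul hb⟩
  | o1 => exact absurd h1 (star_not _ _ _)
  | o2 => exact absurd h1 (star_not _ _ _)
  | s1 => exact absurd h1 (star_not _ _ _)
  | s2 => exact absurd h1 (star_not _ _ _)

lemma W_alg {x} (hx : x ∈ symMutationAlgebra rigidExample) : ∃ c, W x c := by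
  induction hx using Algebra.adjoin_induction with
  | mem x hx => exact W_sym hx
  | algebraMap r => exact ⟨r, by simpa using W.int r⟩
  | add x y _ _ hx hy =>
    obtain ⟨c, hc⟩ := hx
    obtain ⟨d, hd⟩ := hy
    exact ⟨_, hc.add hd⟩
  | mul x y _ _ hx hy =>
    obtain ⟨c, hc⟩ := hx
    obtain ⟨d, hd⟩ := hy
    exact ⟨_, hc.mul hd⟩

lemma y_not : yy ∉ symMutationAlgebra rigidExample := by
  intro h
  obtain ⟨c, h1, h2⟩ := W_alg h
  have e1 := h1.uniq (Vy 1)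
  have e2 := h2.uniq (Vy (-1))
  linarith

lemma y_mem : yy ∈ clusterAlgebra rigidExample := by
  apply Algebra.subset_adjoin
  refine ⟨[0], 0, ?_⟩
  rw [List.foldl_cons, List.foldl_nil, init_eq, cyc_s0 _ _ _ (Or.inl rfl)]
  rfl

end RigidAux

/-- Example 3.3(3): `rigidExample` is skew-symmetrizable, the cluster variable
`(u₂ + u₃)/u₁` obtained by mutating the initial seed at the first index is not a
symmetric cluster variable, and `ℬ(B₀)` is a proper subalgebra of `𝒜(B₀)`. -/
theorem rigid_vertex_example :
    IsSkewSymmetrizable rigidExample ∧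
    (algebraMap (MvPolynomial (Fin 3) ℚ) (ClusterField 3) (MvPolynomial.X 1) +
        algebraMap (MvPolynomial (Fin 3) ℚ) (ClusterField 3) (MvPolynomial.X 2)) /
        algebraMap (MvPolynomial (Fin 3) ℚ) (ClusterField 3) (MvPolynomial.X 0) ∉
      symClusterVars rigidExample ∧
    symMutationAlgebra rigidExample < clusterAlgebra rigidExample := by
  refine ⟨⟨![1, 2, 2], by decide, by decide⟩, fun h => ?_, ?_⟩
  · exact RigidAux.y_not (Algebra.subset_adjoin h)
  · refine lt_of_le_of_ne (Algebra.adjoin_mono ?_) (fun h => ?_)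
    · rintro x ⟨l, i, σ, -, hx⟩
      exact ⟨l, i, hx⟩
    · exact RigidAux.y_not (h ▸ RigidAux.y_mem)
end

section
/- (Example 3.3(1)(b): the (2,2)-triangle) Let B_M be the 3×3 skew-symmetric integer matrix with rows (0, 2, −2), (−2, 0, 2), (2, −2, 0) (an oriented 3-cycle all of whose valuations are (2,2)). Then μ_k(B_M) = −B_M for every index k ∈ {1, 2, 3}, and the cluster algebra 𝒜(B_M) is symmetric, i.e., ℬ(B_M) = 𝒜(B_M). -/
/-- The matrix of Example 3.3(1)(b): an oriented 3-cycle all of whose valuations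
are `(2, 2)`. -/
def triangle22 : Matrix (Fin 3) (Fin 3) ℤ :=
  !![0, 2, -2; -2, 0, 2; 2, -2, 0]


theorem tri_mut (k : Fin 3) : mutate triangle22 k = -triangle22 := by
  revert k; decide

theorem tri_mut_neg (k : Fin 3) : mutate (-triangle22) k = triangle22 := by
  revert k; decide

theorem tri_one : triangle22 = permMat 1 triangle22 := by
  decide

theorem tri_swap : -triangle22 = permMat (Equiv.swap 0 1) triangle22 := by
  decide

theorem tri_reach (l : List (Fin 3)) (s : Seed 3)
    (h : s.2 = triangle22 ∨ s.2 = -triangle22) :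
    (l.foldl seedMutate s).2 = triangle22 ∨ (l.foldl seedMutate s).2 = -triangle22 := by
  induction l generalizing s with
  | nil => exact h
  | cons k l ih =>
    apply ih
    rcases h with h | h
    · right
      change mutate s.2 k = _
      rw [h, tri_mut]
    · left
      change mutate s.2 k = _
      rw [h, tri_mut_neg]

/-- Example 3.3(1)(b): mutation of `triangle22` at any vertex gives `-triangle22`, and
its cluster algebra is symmetric, i.e. `ℬ(B) = 𝒜(B)`. -/
theorem triangle22_symmetric :
    (∀ k : Fin 3, mutate triangle22 k = -triangle22) ∧
    symMutationAlgebra triangle22 = clusterAlgebra triangle22 := by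
  refine ⟨tri_mut, ?_⟩
  have h : symClusterVars triangle22 = clusterVars triangle22 := by
    ext x
    constructor
    · rintro ⟨l, i, _, _, hx⟩
      exact ⟨l, i, hx⟩
    · rintro ⟨l, i, hx⟩
      rcases tri_reach l (initialSeed triangle22) (Or.inl rfl) with h | h
      · exact ⟨l, i, 1, h.trans tri_one, hx⟩
      · exact ⟨l, i, Equiv.swap 0 1, h.trans tri_swap, hx⟩
  unfold symMutationAlgebra clusterAlgebra
  rw [h]
end
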